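/- Let P⁰ and P¹ be hexagonal typical 6-configurations and let p⁰ ∈ P⁰ and p¹ ∈ P¹ be dominant points. Then there is a Q-deformation γ₁,…,γ₆ from P⁰ to P¹ with γ₁(0) = p⁰ and γ₁(1) = p¹ (a Q-deformation taking p⁰ to p¹). -/

import Mathlib

open scoped LinearAlgebra.Projectivization
open Projectivization

noncomputable section

/-- The real projective plane: the projectivization of `ℝ³`. -/
abbrev RP2 := ℙ ℝ (Fin 3 → ℝ)

/-- The quotient topology on the real projective plane. -/
instance : TopologicalSpace RP2 :=
  inferInstanceAs (TopologicalSpace (Quotient (projectivizationSetoid ℝ (Fin 3 → ℝ))))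

/-- Three points of `ℙ²(ℝ)` are collinear if they admit linearly dependent representatives. -/
def Collin (a b c : RP2) : Prop :=
  ¬ LinearIndependent ℝ ![a.rep, b.rep, c.rep]

/-- The conic (zero set in `ℙ²(ℝ)`) associated to a quadratic form on `ℝ³`. -/
def ConicSet (q : QuadraticForm ℝ (Fin 3 → ℝ)) : Set RP2 := {p : RP2 | q p.rep = 0}

/-- A set of points is coconic if some conic contains all of them. -/
def Coconic (s : Set RP2) : Prop :=
  ∃ q : QuadraticForm ℝ (Fin 3 → ℝ), q ≠ 0 ∧ ∀ p ∈ s, q p.rep = 0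

/-- A labeled `n`-configuration is simple if it is injective and has no collinear triple. -/
def SimpleCfg {n : ℕ} (f : Fin n → RP2) : Prop :=
  Function.Injective f ∧
    ∀ i j k : Fin n, i ≠ j → i ≠ k → j ≠ k → ¬ Collin (f i) (f j) (f k)

/-- A labeled `n`-configuration is typical if it is simple and no six of its points are coconic. -/
def TypicalCfg {n : ℕ} (f : Fin n → RP2) : Prop :=
  SimpleCfg f ∧ ∀ g : Fin 6 → Fin n, Function.Injective g → ¬ Coconic (Set.range (f ∘ g))

/-- A projective line: the set of points whose representatives lie in a 2-dimensional
subspace of `ℝ³`. -/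
def IsProjLine (L : Set RP2) : Prop :=
  ∃ W : Submodule ℝ (Fin 3 → ℝ), Module.finrank ℝ W = 2 ∧ L = {p : RP2 | p.rep ∈ W}

/-- `p` lies inside the conic of `q` if every projective line through `p` meets the conic. -/
def InsideConic (q : QuadraticForm ℝ (Fin 3 → ℝ)) (p : RP2) : Prop :=
  ∀ L : Set RP2, IsProjLine L → p ∈ L → (L ∩ ConicSet q).Nonempty

/-- `p` lies outside the conic of `q` if some projective line through `p` misses the conic. -/
def OutsideConic (q : QuadraticForm ℝ (Fin 3 → ℝ)) (p : RP2) : Prop :=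
  ∃ L : Set RP2, IsProjLine L ∧ p ∈ L ∧ L ∩ ConicSet q = ∅

/-- A point `f i` of a configuration is dominant if it lies outside every conic passing
through all the other points of the configuration. -/
def Dominant {n : ℕ} (f : Fin n → RP2) (i : Fin n) : Prop :=
  ∀ q : QuadraticForm ℝ (Fin 3 → ℝ), q ≠ 0 → (∀ j, j ≠ i → q ((f j).rep) = 0) →
    OutsideConic q (f i)

/-- A point `f i` of a configuration is subdominant if it lies inside every conic passing
through all the other points of the configuration. -/
def Subdominant {n : ℕ} (f : Fin n → RP2) (i : Fin n) : Prop :=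
  ∀ q : QuadraticForm ℝ (Fin 3 → ℝ), q ≠ 0 → (∀ j, j ≠ i → q ((f j).rep) = 0) →
    InsideConic q (f i)

/-- The affine chart determined by a nonzero linear functional `φ` (with `L∞ = {φ = 0}`):
a point off `L∞` is sent to its representative rescaled to lie on the affine plane `φ = 1`. -/
def chart (φ : (Fin 3 → ℝ) →ₗ[ℝ] ℝ) (p : RP2) : Fin 3 → ℝ := (φ p.rep)⁻¹ • p.rep

/-- Convex position with respect to the affine chart of `φ`: the line `{φ = 0}` misses the
configuration, and in the chart every point lies outside the convex hull of the others. -/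
def ConvexPosWith {n : ℕ} (φ : (Fin 3 → ℝ) →ₗ[ℝ] ℝ) (f : Fin n → RP2) : Prop :=
  φ ≠ 0 ∧ (∀ i, φ (f i).rep ≠ 0) ∧
    ∀ i, chart φ (f i) ∉ convexHull ℝ (chart φ '' (f '' {j | j ≠ i}))

/-- A configuration is in convex position if it is so in some affine chart. -/
def ConvexPos {n : ℕ} (f : Fin n → RP2) : Prop := ∃ φ, ConvexPosWith φ f

/-- The labeling of a configuration is consecutive for the convex position in the chart of `φ`:
each pair `f i`, `f (i+1)` (cyclically) spans an edge of the convex polygon, i.e. is cut out by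
an affine functional which is strictly larger on both of them than on all the other points. -/
def ConsecWith {n : ℕ} [NeZero n] (φ : (Fin 3 → ℝ) →ₗ[ℝ] ℝ) (f : Fin n → RP2) : Prop :=
  ConvexPosWith φ f ∧
    ∀ i : Fin n, ∃ ψ : (Fin 3 → ℝ) →ₗ[ℝ] ℝ,
      ψ (chart φ (f i)) = ψ (chart φ (f (i + 1))) ∧
      ∀ j : Fin n, j ≠ i → j ≠ i + 1 → ψ (chart φ (f j)) < ψ (chart φ (f i))

/-- A configuration is in convex position with consecutive cyclic labeling. -/
def ConsecConvexPos {n : ℕ} [NeZero n] (f : Fin n → RP2) : Prop := ∃ φ, ConsecWith φ f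

/-- A Q-deformation (an `n`-tuple of continuous paths through typical configurations). -/
def QDeformFam (n : ℕ) (γ : Fin n → unitInterval → RP2) : Prop :=
  (∀ i, Continuous (γ i)) ∧ ∀ t : unitInterval, TypicalCfg (fun i => γ i t)

end

noncomputable section

/-- In the basis adapted to the first two of five points on a conic, the coefficient `α` of the
square and the coefficient `k` in the direction of the line through these two points are linked. -/
theorem conic_coeff_relation {x₀ x₁ x₂ x₃ x₄ a s L M R α β γ k₂ k₁ k₀ : ℝ}
    (h₀₁ : x₀ < x₁) (h₁₂ : x₁ < x₂) (h₂₃ : x₂ < x₃) (h₃₄ : x₃ < x₄)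
    {y : ℝ → ℝ → ℝ} (hy : ∀ t l, y t l = a + s * (t - x₀) + l)
    {l₂ l₃ l₄ : ℝ} (hl₂ : l₂ = (x₂ - x₁) * ((x₂ - x₀) * L))
    (hl₃ : l₃ = (x₃ - x₁) * ((x₂ - x₀) * L + (x₃ - x₂) * M))
    (hl₄ : l₄ = (x₄ - x₁) * (x₂ - x₀) * L + (x₄ - x₂) * (x₃ - x₁) * M
      + (x₄ - x₃) * (x₄ - x₂) * R)
    (hq : ∀ t l, (t = x₀ ∧ l = 0) ∨ (t = x₁ ∧ l = 0) ∨ (t = x₂ ∧ l = l₂) ∨ (t = x₃ ∧ l = l₃) ∨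
      (t = x₄ ∧ l = l₄) → α * y t l ^ 2 + y t l * (β * t + γ) + (k₂ * t ^ 2 + k₁ * t + k₀) = 0) :
    ∃ b c k : ℝ, k = k₂ + β * s + α * s ^ 2 ∧
      (∀ t l, α * y t l ^ 2 + y t l * (β * t + γ) + (k₂ * t ^ 2 + k₁ * t + k₀) =
        α * l ^ 2 + l * (b * t + c) + k * ((t - x₀) * (t - x₁))) ∧
      α * (R * L * ((x₂ - x₀) * L + (x₃ - x₂) * M) * l₄) =
        k * ((x₄ - x₀) * L * R - M * ((x₃ - x₁) * M + (x₄ - x₃) * R + (x₁ - x₀) * L)) := by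
  have e0 := hq x₀ 0 (by simp)
  have e1 := hq x₁ 0 (by simp)
  have e2 := hq x₂ l₂ (by simp)
  have e3 := hq x₃ l₃ (by simp)
  have e4 := hq x₄ l₄ (by simp)
  have hE : ∀ t l, α * y t l ^ 2 + y t l * (β * t + γ) + (k₂ * t ^ 2 + k₁ * t + k₀) =
        α * l ^ 2 + l * ((β + 2 * α * s) * t + (γ + 2 * α * (a - s * x₀)))
          + (k₂ + β * s + α * s ^ 2) * ((t - x₀) * (t - x₁)) := by
    have hne : x₁ - x₀ ≠ 0 := by linarith
    intro t l
    rw [hy] at e0 e1 ⊢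
    apply mul_left_cancel₀ hne
    linear_combination (x₁ - t) * e0 + (t - x₀) * e1
  refine ⟨β + 2 * α * s, γ + 2 * α * (a - s * x₀), _, rfl, hE, ?_⟩
  rw [hE] at e2 e3 e4
  generalize k₂ + β * s + α * s ^ 2 = k at *
  generalize β + 2 * α * s = b at *
  generalize γ + 2 * α * (a - s * x₀) = c at *
  have f2 : L * (α * l₂ + b * x₂ + c) + k = 0 := by
    have hne : (x₂ - x₁) * (x₂ - x₀) ≠ 0 := (mul_pos (by linarith) (by linarith)).ne'
    apply mul_left_cancel₀ hne
    rw [hl₂] at e2 ⊢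
    linear_combination e2
  have f3 : ((x₂ - x₀) * L + (x₃ - x₂) * M) * (α * l₃ + b * x₃ + c) + k * (x₃ - x₀) = 0 := by
    have hne : (x₃ - x₁) ≠ 0 := by linarith
    apply mul_left_cancel₀ hne
    rw [hl₃] at e3 ⊢
    linear_combination e3
  have hV : (x₃ - x₂) * (x₄ - x₃) * (x₄ - x₂) ≠ 0 :=
    (mul_pos (mul_pos (by linarith) (by linarith)) (by linarith)).ne'
  apply mul_left_cancel₀ hV
  have hlc : (x₄ - x₃) * l₂ - (x₄ - x₂) * l₃ + (x₃ - x₂) * l₄ =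
      R * ((x₃ - x₂) * (x₄ - x₃) * (x₄ - x₂)) := by
    rw [hl₂, hl₃, hl₄]; ring
  have hH : (x₄ - x₃) * ((x₂ - x₀) * L + (x₃ - x₂) * M) * l₄
      - (x₄ - x₂) * (x₃ - x₀) * L * l₄
      + (x₃ - x₂) * ((x₄ - x₀) * (x₄ - x₁)) * L * ((x₂ - x₀) * L + (x₃ - x₂) * M) =
      - ((x₃ - x₂) * (x₄ - x₃) * (x₄ - x₂)) * ((x₄ - x₀) * L * R
        - M * ((x₃ - x₁) * M + (x₄ - x₃) * R + (x₁ - x₀) * L)) := by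
    rw [hl₄]; ring
  generalize (x₂ - x₀) * L + (x₃ - x₂) * M = m at *
  linear_combination (x₄ - x₃) * m * l₄ * f2 - (x₄ - x₂) * L * l₄ * f3
    + (x₃ - x₂) * L * m * e4 - α * L * m * l₄ * hlc - k * hH

/-- The deviations of five points of a convex graph from the line through the first two of them,
in terms of the second divided differences `c 2`, `c 3`, `c 4` of consecutive triples. -/
def deviation (x c : Fin 5 → ℝ) : Fin 5 → ℝ :=
  ![0, 0, (x 2 - x 1) * ((x 2 - x 0) * c 2),
    (x 3 - x 1) * ((x 2 - x 0) * c 2 + (x 3 - x 2) * c 3),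
    (x 4 - x 1) * (x 2 - x 0) * c 2 + (x 4 - x 2) * (x 3 - x 1) * c 3
      + (x 4 - x 3) * (x 4 - x 2) * c 4]

/-- The ordinates of five points with abscissas `x`, initial value `c 0`, initial slope `c 1` and
consecutive second divided differences `c 2`, `c 3`, `c 4`. -/
def ordinate (x c : Fin 5 → ℝ) (j : Fin 5) : ℝ := c 0 + c 1 * (x j - x 0) + deviation x c j

/-- Six vectors representing the vertical point at infinity and five affine points. -/
def verticalCfg (x y : Fin 5 → ℝ) : Fin 6 → Fin 3 → ℝ :=
  Fin.cons ![0, 0, 1] fun j => ![1, x j, y j]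

/-- Increasing abscissas and positive second divided differences. -/
structure ConvexData (x c : Fin 5 → ℝ) : Prop where
  lt₀₁ : x 0 < x 1
  lt₁₂ : x 1 < x 2
  lt₂₃ : x 2 < x 3
  lt₃₄ : x 3 < x 4
  pos₂ : 0 < c 2
  pos₃ : 0 < c 3
  pos₄ : 0 < c 4

/-- Positive exactly when the vertical point at infinity lies outside the conic through
the five affine points. -/
def outerness (x c : Fin 5 → ℝ) : ℝ :=
  (x 4 - x 0) * c 2 * c 4 - c 3 * ((x 3 - x 1) * c 3 + (x 4 - x 3) * c 4 + (x 1 - x 0) * c 2)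

theorem ConvexData.deviation_pos {x c : Fin 5 → ℝ} (h : ConvexData x c) :
    0 < deviation x c 2 ∧ 0 < deviation x c 3 ∧ 0 < deviation x c 4 := by
  obtain ⟨h0, h1, h2, h3, p2, p3, p4⟩ := h
  have a1 : 0 < x 2 - x 1 := by linarith
  have a2 : 0 < x 2 - x 0 := by linarith
  have a3 : 0 < x 3 - x 1 := by linarith
  have a4 : 0 < x 3 - x 2 := by linarith
  have a5 : 0 < x 4 - x 1 := by linarith
  have a6 : 0 < x 4 - x 2 := by linarith
  have a7 : 0 < x 4 - x 3 := by linarith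
  refine ⟨?_, ?_, ?_⟩ <;> simp only [deviation, Matrix.cons_val] <;> positivity

/-- Coordinates of a ternary quadratic form. -/
theorem exists_coeffs (q : QuadraticForm ℝ (Fin 3 → ℝ)) :
    ∃ α β γ k₂ k₁ k₀ : ℝ, ∀ u : Fin 3 → ℝ, q u =
      α * u 2 ^ 2 + u 2 * (β * u 1 + γ * u 0) + (k₂ * u 1 ^ 2 + k₁ * (u 0 * u 1) + k₀ * u 0 ^ 2) := by
  refine ⟨q ![0, 0, 1], QuadraticMap.polar q ![0, 1, 0] ![0, 0, 1],
    QuadraticMap.polar q ![1, 0, 0] ![0, 0, 1], q ![0, 1, 0],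
    QuadraticMap.polar q ![1, 0, 0] ![0, 1, 0], q ![1, 0, 0], fun u => ?_⟩
  have hu : u = (u 0 • ![1, 0, 0] + u 1 • ![0, 1, 0]) + u 2 • ![0, 0, 1] := by
    ext i; fin_cases i <;> simp
  conv_lhs => rw [hu]
  simp only [QuadraticMap.map_add q, QuadraticMap.map_smul, QuadraticMap.polar_add_left,
    QuadraticMap.polar_smul_left, QuadraticMap.polar_smul_right, smul_eq_mul]
  ring

theorem ConvexData.relation {x c : Fin 5 → ℝ} (h : ConvexData x c)
    {α β γ k₂ k₁ k₀ : ℝ}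
    (hq : ∀ j, α * ordinate x c j ^ 2 + ordinate x c j * (β * x j + γ) +
      (k₂ * x j ^ 2 + k₁ * x j + k₀) = 0) :
    ∃ b d k : ℝ, k = k₂ + β * c 1 + α * c 1 ^ 2 ∧
      (∀ t l, α * (c 0 + c 1 * (t - x 0) + l) ^ 2 + (c 0 + c 1 * (t - x 0) + l) * (β * t + γ)
        + (k₂ * t ^ 2 + k₁ * t + k₀) =
        α * l ^ 2 + l * (b * t + d) + k * ((t - x 0) * (t - x 1))) ∧
      ∃ P, 0 < P ∧ α * P = k * outerness x c := by
  obtain ⟨d2, d3, d4⟩ := h.deviation_pos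
  have hm : 0 < (x 2 - x 0) * c 2 + (x 3 - x 2) * c 3 := by
    have := mul_pos (sub_pos.2 h.lt₂₃) h.pos₃
    have := mul_pos (sub_pos.2 (h.lt₀₁.trans h.lt₁₂)) h.pos₂
    linarith
  obtain ⟨b, d, k, hk, hE, hP⟩ := conic_coeff_relation (a := c 0) (s := c 1) (L := c 2) (M := c 3)
    (R := c 4) (α := α) (β := β) (γ := γ) (k₂ := k₂) (k₁ := k₁) (k₀ := k₀)
    h.lt₀₁ h.lt₁₂ h.lt₂₃ h.lt₃₄ (y := fun t l => c 0 + c 1 * (t - x 0) + l) (fun _ _ => rfl)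
    (l₂ := deviation x c 2) (l₃ := deviation x c 3) (l₄ := deviation x c 4) rfl rfl rfl (by
      rintro t l (⟨rfl, rfl⟩ | ⟨rfl, rfl⟩ | ⟨rfl, rfl⟩ | ⟨rfl, rfl⟩ | ⟨rfl, rfl⟩)
      exacts [hq 0, hq 1, hq 2, hq 3, hq 4])
  exact ⟨b, d, k, hk, hE, _, mul_pos (mul_pos (mul_pos h.pos₄ h.pos₂) hm) d4, hP⟩

theorem ConvexData.eq_zero_of_conic {x c : Fin 5 → ℝ} (h : ConvexData x c)
    (hD : outerness x c ≠ 0) {q : QuadraticForm ℝ (Fin 3 → ℝ)}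
    (hq : ∀ i, q (verticalCfg x (ordinate x c) i) = 0) : q = 0 := by
  obtain ⟨α, β, γ, k₂, k₁, k₀, hu⟩ := exists_coeffs q
  have hα : α = 0 := by simpa [verticalCfg, hu] using hq 0
  have hj : ∀ j, α * ordinate x c j ^ 2 + ordinate x c j * (β * x j + γ) +
      (k₂ * x j ^ 2 + k₁ * x j + k₀) = 0 := fun j => by
    simpa [verticalCfg, hu] using hq j.succ
  obtain ⟨b, d, k, hk, hE, P, -, hP⟩ := h.relation hj
  obtain ⟨d2, d3, d4⟩ := h.deviation_pos
  subst hα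
  have hk0 : k = 0 := by simpa [hD] using hP.symm
  subst hk0
  have e2 := (hE (x 2) (deviation x c 2)).symm.trans (hj 2)
  have e3 := (hE (x 3) (deviation x c 3)).symm.trans (hj 3)
  have f2 : b * x 2 + d = 0 := by simpa [d2.ne'] using e2
  have f3 : b * x 3 + d = 0 := by simpa [d3.ne'] using e3
  have hb : b = 0 := by
    have : x 3 - x 2 ≠ 0 := (sub_pos.2 h.lt₂₃).ne'
    exact mul_left_cancel₀ this (by linear_combination f3 - f2)
  subst hb
  have hd : d = 0 := by simpa using f2
  subst hd
  have z : ∀ t l, l * (β * t + γ) + (k₂ * t ^ 2 + k₁ * t + k₀) = 0 := fun t l => by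
    have := hE t (l - (c 0 + c 1 * (t - x 0)))
    simpa using this
  have z0 := z 0 0
  have z1 := z 0 1
  have z2 := z 1 1
  have z3 := z 1 0
  have z4 := z (-1) 0
  have hγ : γ = 0 := by linarith
  have hβ : β = 0 := by linarith
  have h2 : k₂ = 0 := by linarith
  have h1 : k₁ = 0 := by linarith
  have h0 : k₀ = 0 := by linarith
  ext u
  simp [hu, hγ, hβ, h2, h1, h0]

/-- Data of the mirror image under `x ↦ -x`. -/
theorem ConvexData.mirror {x c : Fin 5 → ℝ} (h : ConvexData x c) :
    ∃ x' c' : Fin 5 → ℝ, ConvexData x' c' ∧ outerness x' c' = outerness x c ∧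
      (∀ j, x' j = - x j.rev) ∧ ∀ j, ordinate x' c' j = ordinate x c j.rev := by
  refine ⟨fun j => - x j.rev, ![ordinate x c 4,
    -(c 1 + (x 2 - x 0) * c 2 + (x 3 - x 1) * c 3 + (x 4 - x 2) * c 4), c 4, c 3, c 2], ?_, ?_,
    fun _ => rfl, ?_⟩
  · obtain ⟨h0, h1, h2, h3, p2, p3, p4⟩ := h
    constructor <;> simpa [Fin.rev]
  · simp [outerness, Fin.rev]; ring
  · intro j
    fin_cases j <;> simp [ordinate, deviation, Fin.rev] <;> ring

/-- If `outerness` is nonpositive, every vertical line meets the conic. -/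
theorem ConvexData.exists_root {x c : Fin 5 → ℝ} (h : ConvexData x c)
    (hD : outerness x c ≤ 0) {q : QuadraticForm ℝ (Fin 3 → ℝ)} (h0 : q ![0, 0, 1] ≠ 0)
    (hq : ∀ j, q ![1, x j, ordinate x c j] = 0) (a b : ℝ) : ∃ z, q ![a, b, z] = 0 := by
  obtain ⟨α, β, γ, k₂, k₁, k₀, hu⟩ := exists_coeffs q
  have hα : α ≠ 0 := by simpa [hu] using h0
  have hj : ∀ j, α * ordinate x c j ^ 2 + ordinate x c j * (β * x j + γ) +
      (k₂ * x j ^ 2 + k₁ * x j + k₀) = 0 := fun j => by simpa [hu] using hq j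
  obtain ⟨x', c', h', ho, hx', hy'⟩ := h.mirror
  have key : ∀ {x c : Fin 5 → ℝ} {β k₁ : ℝ} (_ : ConvexData x c) (_ : outerness x c ≤ 0)
      (_ : ∀ j, α * ordinate x c j ^ 2 + ordinate x c j * (β * x j + γ) +
        (k₂ * x j ^ 2 + k₁ * x j + k₀) = 0) (b : ℝ), 0 ≤ (b - a * x 0) * (b - a * x 1) →
      ∃ z, α * (α * z ^ 2 + z * (β * b + γ * a) + (k₂ * b ^ 2 + k₁ * (a * b) + k₀ * a ^ 2)) ≤ 0 := by
    intro x c β k₁ h hD hj b hb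
    obtain ⟨e, d, k, hk, hE, P, hP, hkP⟩ := h.relation hj
    have hαk : α * k ≤ 0 := by
      by_contra! hc
      have : α ^ 2 * P = α * k * outerness x c := by linear_combination α * hkP
      have : 0 < α ^ 2 * P := by positivity
      nlinarith
    refine ⟨a * c 0 + c 1 * (b - a * x 0), ?_⟩
    have hval : α * (a * c 0 + c 1 * (b - a * x 0)) ^ 2
        + (a * c 0 + c 1 * (b - a * x 0)) * (β * b + γ * a)
        + (k₂ * b ^ 2 + k₁ * (a * b) + k₀ * a ^ 2) = k * ((b - a * x 0) * (b - a * x 1)) := by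
      have z0 := hE 0 0
      have z1 := hE 1 0
      have zm := hE (-1) 0
      subst hk
      linear_combination a ^ 2 * z0 + a * b / 2 * (z1 - zm)
    rw [hval]
    nlinarith
  have hz : ∃ z, α * q ![a, b, z] ≤ 0 := by
    simp only [hu, Matrix.cons_val]
    by_cases hb : 0 ≤ (b - a * x 0) * (b - a * x 1)
    · exact key h hD hj b hb
    · have hb' : 0 ≤ (-b - a * x' 0) * (-b - a * x' 1) := by
        simp only [hx', Fin.rev, Fin.isValue]
        change 0 ≤ (-b - a * -x 4) * (-b - a * -x 3)
        push Not at hb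
        obtain ⟨l0, l1, l2, l3, -⟩ := h
        rcases lt_trichotomy a 0 with ha | ha | ha
        · have : b - a * x 0 < b - a * x 1 := by nlinarith
          have : b - a * x 1 < b - a * x 3 := by nlinarith
          have : b - a * x 3 < b - a * x 4 := by nlinarith
          have : 0 < b - a * x 1 := by by_contra!; nlinarith
          nlinarith
        · subst ha; nlinarith [mul_self_nonneg b]
        · have : b - a * x 1 < b - a * x 0 := by nlinarith
          have : b - a * x 3 < b - a * x 1 := by nlinarith
          have : b - a * x 4 < b - a * x 3 := by nlinarith
          have : b - a * x 1 < 0 := by by_contra!; nlinarith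
          nlinarith
      obtain ⟨z, hz⟩ := key (β := -β) (k₁ := -k₁) h' (ho.trans_le hD) (fun j => by
        rw [hx', hy']; linear_combination hj j.rev) (-b) hb'
      exact ⟨z, by linarith⟩
  obtain ⟨w, hw⟩ := hz
  simp only [hu, Matrix.cons_val] at hw ⊢
  set B := β * b + γ * a
  set C := k₂ * b ^ 2 + k₁ * (a * b) + k₀ * a ^ 2
  have hdisc : 0 ≤ discrim α B C := by
    unfold discrim
    nlinarith [sq_nonneg (2 * α * w + B)]
  obtain ⟨z, hz⟩ := exists_quadratic_eq_zero hα ⟨_, (Real.mul_self_sqrt hdisc).symm⟩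
  exact ⟨z, by linear_combination hz⟩

/-- A family of six vectors representing a typical configuration. -/
structure TypicalVec (v : Fin 6 → Fin 3 → ℝ) : Prop where
  indep : ∀ i j k : Fin 6, i ≠ j → i ≠ k → j ≠ k → LinearIndependent ℝ ![v i, v j, v k]
  conic : ∀ q : QuadraticForm ℝ (Fin 3 → ℝ), (∀ i, q (v i) = 0) → q = 0

theorem TypicalVec.smul {v : Fin 6 → Fin 3 → ℝ} (h : TypicalVec v) {a : Fin 6 → ℝ}
    (ha : ∀ i, a i ≠ 0) : TypicalVec fun i => a i • v i := by
  refine ⟨fun i j k hij hik hjk => ?_, fun q hq => h.conic q fun i => ?_⟩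
  · have := (h.indep i j k hij hik hjk).units_smul
      ![Units.mk0 _ (ha i), Units.mk0 _ (ha j), Units.mk0 _ (ha k)]
    convert this using 1
    ext l : 1
    fin_cases l <;> rfl
  · simpa [QuadraticMap.map_smul, ha i] using hq i

theorem TypicalVec.mulVec {v : Fin 6 → Fin 3 → ℝ} (h : TypicalVec v)
    {B : Matrix (Fin 3) (Fin 3) ℝ} (hB : B.det ≠ 0) : TypicalVec fun i => B.mulVec (v i) := by
  have hu : IsUnit B := (Matrix.isUnit_iff_isUnit_det B).2 hB.isUnit
  refine ⟨fun i j k hij hik hjk => ?_, fun q hq => ?_⟩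
  · have := (h.indep i j k hij hik hjk).map' B.mulVecLin
      (LinearMap.ker_eq_bot.2 (Matrix.mulVec_injective_iff_isUnit.2 hu))
    rwa [show B.mulVecLin ∘ ![v i, v j, v k] = ![B.mulVec (v i), B.mulVec (v j), B.mulVec (v k)]
      by ext l : 1; fin_cases l <;> rfl] at this
  · have h0 := h.conic (q.comp B.mulVecLin) (by simpa using hq)
    ext u
    obtain ⟨w, rfl⟩ := Matrix.mulVec_surjective_iff_isUnit.2 hu u
    simpa using congrArg (fun r : QuadraticForm ℝ (Fin 3 → ℝ) => r w) h0

theorem TypicalVec.ne_zero {v : Fin 6 → Fin 3 → ℝ} (h : TypicalVec v) (i : Fin 6) : v i ≠ 0 := by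
  obtain ⟨j, k, hij, hik, hjk⟩ : ∃ j k : Fin 6, i ≠ j ∧ i ≠ k ∧ j ≠ k := by
    revert i; decide
  simpa using (h.indep i j k hij hik hjk).ne_zero 0

theorem typicalCfg_iff (f : Fin 6 → RP2) : TypicalCfg f ↔ TypicalVec fun i => (f i).rep := by
  constructor
  · rintro ⟨⟨-, hs⟩, hc⟩
    refine ⟨fun i j k hij hik hjk => not_not.1 (hs i j k hij hik hjk), fun q hq => ?_⟩
    by_contra h0
    exact hc id Function.injective_id ⟨q, h0, by rintro _ ⟨i, rfl⟩; exact hq i⟩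
  · intro h
    have hs : ∀ i j k : Fin 6, i ≠ j → i ≠ k → j ≠ k → ¬ Collin (f i) (f j) (f k) :=
      fun i j k hij hik hjk => not_not.2 (h.indep i j k hij hik hjk)
    refine ⟨⟨fun i j hij => ?_, hs⟩, ?_⟩
    · by_contra hne
      obtain ⟨k, hik, hjk⟩ : ∃ k : Fin 6, i ≠ k ∧ j ≠ k := by
        clear hij hne; revert i j; decide
      have := (h.indep i j k hne hik hjk).injective.ne (a₁ := 0) (a₂ := 1) (by decide)
      simp [hij] at this
    · rintro g hg ⟨q, h0, hq⟩
      refine h0 (h.conic q fun i => ?_)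
      obtain ⟨j, rfl⟩ := (Finite.injective_iff_surjective.1 hg) i
      exact hq _ ⟨j, rfl⟩

/-- The point of the projective plane represented by a vector (with a junk value at `0`). -/
def toRP (v : Fin 3 → ℝ) : RP2 :=
  if h : v = 0 then Projectivization.mk ℝ (Pi.single 0 1) (by simp) else Projectivization.mk ℝ v h

theorem toRP_smul {v : Fin 3 → ℝ} {a : ℝ} (ha : a ≠ 0) : toRP (a • v) = toRP v := by
  by_cases h : v = 0
  · simp [h]
  · rw [toRP, toRP, dif_neg h, dif_neg (smul_ne_zero ha h), Projectivization.mk_eq_mk_iff']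
    exact ⟨a, rfl⟩

theorem toRP_rep (p : RP2) : toRP p.rep = p := by
  rw [toRP, dif_neg p.rep_nonzero, Projectivization.mk_rep]

theorem exists_smul_eq_rep_toRP {v : Fin 3 → ℝ} (h : v ≠ 0) :
    ∃ a : ℝ, a ≠ 0 ∧ (toRP v).rep = a • v := by
  obtain ⟨a, ha⟩ := Projectivization.exists_smul_eq_mk_rep ℝ v h
  exact ⟨a, a.ne_zero, by rw [toRP, dif_neg h, ← ha]; rfl⟩

theorem continuousOn_toRP : ContinuousOn toRP {0}ᶜ := by
  rw [continuousOn_iff_continuous_domRestrict]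
  have : Continuous (fun v : { v : Fin 3 → ℝ // v ≠ 0 } =>
      (Quotient.mk (projectivizationSetoid ℝ (Fin 3 → ℝ)) v : RP2)) := continuous_quotient_mk'
  refine this.congr fun v => ?_
  change _ = toRP v.1
  rw [toRP, dif_neg v.2]
  rfl

theorem TypicalVec.typicalCfg {v : Fin 6 → Fin 3 → ℝ} (h : TypicalVec v) :
    TypicalCfg fun i => toRP (v i) := by
  rw [typicalCfg_iff]
  choose a ha hav using fun i => exists_smul_eq_rep_toRP (h.ne_zero i)
  simpa only [hav] using h.smul ha

/-- A path of typical families of vectors gives a path of typical configurations. -/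
theorem joinedIn_of_path {v : ℝ → Fin 6 → Fin 3 → ℝ} (hc : Continuous v)
    (hv : ∀ t ∈ unitInterval, TypicalVec (v t)) :
    JoinedIn {f : Fin 6 → RP2 | TypicalCfg f} (fun i => toRP (v 0 i)) fun i => toRP (v 1 i) := by
  refine JoinedIn.ofLine (f := fun t i => toRP (v t i)) ?_ rfl rfl ?_
  · refine continuousOn_pi.2 fun i => continuousOn_toRP.comp
      (continuous_pi_iff.1 hc i).continuousOn fun t ht => (hv t ht).ne_zero i
  · rintro _ ⟨t, ht, rfl⟩
    exact (hv t ht).typicalCfg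

/-- The action of `B` moves typical configurations within their deformation classes. -/
def ActsByDeformation (B : Matrix (Fin 3) (Fin 3) ℝ) : Prop :=
  ∀ v : Fin 6 → Fin 3 → ℝ, TypicalVec v →
    JoinedIn {f : Fin 6 → RP2 | TypicalCfg f} (fun i => toRP (v i)) fun i => toRP (B.mulVec (v i))

theorem ActsByDeformation.mul {A B : Matrix (Fin 3) (Fin 3) ℝ} (hA : ActsByDeformation A)
    (hB : ActsByDeformation B) (hdet : B.det ≠ 0) : ActsByDeformation (A * B) := by
  intro v hv
  simpa only [Matrix.mulVec_mulVec] using (hB v hv).trans (hA _ (hv.mulVec hdet))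

theorem ActsByDeformation.smul {A : Matrix (Fin 3) (Fin 3) ℝ} (hA : ActsByDeformation A)
    {a : ℝ} (ha : a ≠ 0) : ActsByDeformation (a • A) := by
  intro v hv
  simpa only [Matrix.smul_mulVec, toRP_smul ha] using hA v hv

theorem actsByDeformation_of_segment {B : Matrix (Fin 3) (Fin 3) ℝ}
    (h : ∀ t : ℝ, 0 ≤ t → t ≤ 1 → ((1 - t) • 1 + t • B).det ≠ 0) : ActsByDeformation B := by
  intro v hv
  have := joinedIn_of_path (v := fun t i => ((1 - t) • 1 + t • B).mulVec (v i))
    (by fun_prop) fun t ht => hv.mulVec (h t ht.1 ht.2)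
  simpa using this

theorem actsByDeformation_diagonal_pos {d : Fin 3 → ℝ} (hd : ∀ i, 0 < d i) :
    ActsByDeformation (Matrix.diagonal d) := by
  refine actsByDeformation_of_segment fun t h0 h1 => ?_
  have : (1 - t) • (1 : Matrix (Fin 3) (Fin 3) ℝ) + t • Matrix.diagonal d =
      Matrix.diagonal fun i => (1 - t) + t * d i := by
    ext i j
    by_cases hij : i = j <;> simp [hij]
  rw [this, Matrix.det_diagonal]
  refine (Finset.prod_pos fun i _ => ?_).ne'
  have := hd i
  rcases h0.eq_or_lt with rfl | h0
  · simp
  · have := mul_pos h0 this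
    linarith

theorem actsByDeformation_diagonal {d : Fin 3 → ℝ} (hd : ∀ i, d i ≠ 0) :
    ActsByDeformation (Matrix.diagonal d) := by
  have hJ₀ : ActsByDeformation !![1, 0, 0; 0, 0, -1; 0, 1, 0] := by
    refine actsByDeformation_of_segment fun t h0 h1 => ?_
    simp [Matrix.det_fin_three]
    nlinarith [sq_nonneg (1 - 2 * t)]
  have hJ₁ : ActsByDeformation !![0, 0, -1; 0, 1, 0; 1, 0, 0] := by
    refine actsByDeformation_of_segment fun t h0 h1 => ?_
    simp [Matrix.det_fin_three]
    nlinarith [sq_nonneg (1 - 2 * t)]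
  have h₀ : ActsByDeformation (Matrix.diagonal ![1, -1, -1]) := by
    have := hJ₀.mul hJ₀ (by simp [Matrix.det_fin_three])
    convert this using 1
    ext i j
    fin_cases i <;> fin_cases j <;> simp
  have h₁ : ActsByDeformation (Matrix.diagonal ![-1, 1, -1]) := by
    have := hJ₁.mul hJ₁ (by simp [Matrix.det_fin_three])
    convert this using 1
    ext i j
    fin_cases i <;> fin_cases j <;> simp
  have key : ∀ {e d : Fin 3 → ℝ}, ActsByDeformation (Matrix.diagonal e) → (∀ i, 0 < e i * d i) →
      ActsByDeformation (Matrix.diagonal d) := by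
    intro e d he hed
    have hne : ∀ i, e i ≠ 0 := fun i h => by simpa [h] using hed i
    have := he.mul (actsByDeformation_diagonal_pos (d := fun i => d i / e i) fun i => by
      have := div_pos (hed i) (mul_self_pos.2 (hne i))
      rwa [mul_div_mul_left _ _ (hne i)] at this)
      (by
        rw [Matrix.det_diagonal]
        refine Finset.prod_ne_zero_iff.2 fun i _ => div_ne_zero (fun h => ?_) (hne i)
        simpa [h] using hed i)
    rwa [Matrix.diagonal_mul_diagonal,
      show (fun i => e i * (d i / e i)) = d from funext fun i => mul_div_cancel₀ _ (hne i)] at this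
  have h₂ : ActsByDeformation (Matrix.diagonal ![-1, -1, 1]) := by
    have := h₀.mul h₁ (by simp [Matrix.det_diagonal, Fin.prod_univ_three])
    rwa [Matrix.diagonal_mul_diagonal,
      show (fun i => (![1, -1, -1] i * ![-1, 1, -1] i : ℝ)) = ![-1, -1, 1] by
        ext i; fin_cases i <;> simp] at this
  have even : ∀ {d : Fin 3 → ℝ}, 0 < d 0 * d 1 * d 2 → ActsByDeformation (Matrix.diagonal d) := by
    intro d hd
    rcases pos_and_pos_or_neg_and_neg_of_mul_pos hd with ⟨h01, h2⟩ | ⟨h01, h2⟩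
    · rcases pos_and_pos_or_neg_and_neg_of_mul_pos h01 with ⟨h0, h1⟩ | ⟨h0, h1⟩
      · exact actsByDeformation_diagonal_pos (by simp [Fin.forall_fin_succ, *])
      · exact key h₂ (by simp [Fin.forall_fin_succ, *])
    · rcases mul_neg_iff.1 h01 with ⟨h0, h1⟩ | ⟨h0, h1⟩
      · exact key h₀ (by simp [Fin.forall_fin_succ, *])
      · exact key h₁ (by simp [Fin.forall_fin_succ, *])
  have hp : d 0 * d 1 * d 2 ≠ 0 := mul_ne_zero (mul_ne_zero (hd 0) (hd 1)) (hd 2)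
  rcases hp.lt_or_gt with hn | hp
  · have := (even (d := -d) (by simp only [Pi.neg_apply]; linarith)).smul (neg_ne_zero.2 one_ne_zero)
    simpa using this
  · exact even hp

theorem actsByDeformation {B : Matrix (Fin 3) (Fin 3) ℝ} (hB : B.det ≠ 0) :
    ActsByDeformation B := by
  refine Matrix.diagonal_transvection_induction_of_det_ne_zero _ B hB ?_ ?_
    fun A B _ hB hA' hB' => hA'.mul hB' hB
  · intro D hD
    rw [Matrix.det_diagonal, Finset.prod_ne_zero_iff] at hD
    exact actsByDeformation_diagonal fun i => hD i (Finset.mem_univ i)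
  · intro s
    refine actsByDeformation_of_segment fun t _ _ => ?_
    have : (1 - t) • (1 : Matrix (Fin 3) (Fin 3) ℝ) + t • s.toMatrix =
        Matrix.transvection s.i s.j (t * s.c) := by
      simp only [Matrix.TransvectionStruct.toMatrix, Matrix.transvection]
      ext i j
      simp [Matrix.single_apply]
      split_ifs <;> ring
    rw [this, Matrix.det_transvection_of_ne _ _ s.hij]
    exact one_ne_zero

theorem linearIndependent_iff_det {a b c : Fin 3 → ℝ} :
    LinearIndependent ℝ ![a, b, c] ↔ (Matrix.of ![a, b, c]).det ≠ 0 := by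
  rw [← isUnit_iff_ne_zero, ← Matrix.isUnit_iff_isUnit_det]
  exact Matrix.linearIndependent_rows_iff_isUnit (A := Matrix.of ![a, b, c])

theorem ConvexData.strictMono {x c : Fin 5 → ℝ} (h : ConvexData x c) : StrictMono x := by
  refine Fin.strictMono_iff_lt_succ.2 fun i => ?_
  fin_cases i
  exacts [h.lt₀₁, h.lt₁₂, h.lt₂₃, h.lt₃₄]

/-- Twice the signed area of a triangle formed by three points of a plane polygonal line. -/
def area (x y : Fin 5 → ℝ) (i j k : Fin 5) : ℝ :=
  (x j - x i) * (y k - y j) - (x k - x j) * (y j - y i)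

theorem ConvexData.area_pos {x c : Fin 5 → ℝ} (h : ConvexData x c) {i j k : Fin 5} (hij : i < j)
    (hjk : j < k) : 0 < area x (ordinate x c) i j k := by
  have p0 := sub_pos.2 h.lt₀₁
  have p1 := sub_pos.2 h.lt₁₂
  have p2 := sub_pos.2 h.lt₂₃
  have p3 := sub_pos.2 h.lt₃₄
  have q0 : 0 < (x 2 - x 0) * c 2 := mul_pos (by linarith) h.pos₂
  have q1 : 0 < (x 3 - x 1) * c 3 := mul_pos (by linarith) h.pos₃
  have q2 : 0 < (x 4 - x 2) * c 4 := mul_pos (by linarith) h.pos₄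
  have a01 := mul_pos (mul_pos p0 p1) q0
  have a12 := mul_pos (mul_pos p1 p2) q1
  have a23 := mul_pos (mul_pos p2 p3) q2
  have a02 := mul_pos (mul_pos p0 p2) (add_pos q0 q1)
  have a13 := mul_pos (mul_pos p1 p3) (add_pos q1 q2)
  have a03 := mul_pos (mul_pos p0 p3) (add_pos (add_pos q0 q1) q2)
  fin_cases i <;> fin_cases j <;> fin_cases k <;>
    first
    | exact absurd hij (by decide)
    | exact absurd hjk (by decide)
    | (simp only [area, ordinate, deviation, Matrix.cons_val, Fin.zero_eta, Fin.mk_one,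
        Fin.reduceFinMk]
       linarith)

theorem det_verticalCfg_zero (x y : Fin 5 → ℝ) (j k : Fin 5) :
    (Matrix.of ![verticalCfg x y 0, verticalCfg x y j.succ, verticalCfg x y k.succ]).det
      = x k - x j := by
  simp [verticalCfg, Matrix.det_fin_three]

theorem det_verticalCfg_succ (x y : Fin 5 → ℝ) (i j k : Fin 5) :
    (Matrix.of ![verticalCfg x y i.succ, verticalCfg x y j.succ, verticalCfg x y k.succ]).det
      = area x y i j k := by
  simp [verticalCfg, Matrix.det_fin_three, area]
  ring

theorem ConvexData.typicalVec {x c : Fin 5 → ℝ} (h : ConvexData x c) (hD : 0 < outerness x c) :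
    TypicalVec (verticalCfg x (ordinate x c)) := by
  refine ⟨?_, fun q hq => h.eq_zero_of_conic hD.ne' hq⟩
  have main : ∀ i j k : Fin 6, i < j → j < k → LinearIndependent ℝ
      ![verticalCfg x (ordinate x c) i, verticalCfg x (ordinate x c) j,
        verticalCfg x (ordinate x c) k] := by
    intro i j k hij hjk
    rw [linearIndependent_iff_det]
    obtain ⟨j, rfl⟩ := Fin.exists_succ_eq.2 (Fin.pos_iff_ne_zero.1 (i.zero_le.trans_lt hij))
    obtain ⟨k, rfl⟩ := Fin.exists_succ_eq.2 (Fin.pos_iff_ne_zero.1 (j.succ.zero_le.trans_lt hjk))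
    rw [Fin.succ_lt_succ_iff] at hjk
    cases i using Fin.cases with
    | zero =>
      rw [det_verticalCfg_zero]
      exact (sub_pos.2 (h.strictMono hjk)).ne'
    | succ i =>
      rw [det_verticalCfg_succ]
      exact (h.area_pos (Fin.succ_lt_succ_iff.1 hij) hjk).ne'
  have s₁ : ∀ a b c : Fin 3 → ℝ, LinearIndependent ℝ ![a, b, c] →
      LinearIndependent ℝ ![b, a, c] := by
    intro a b c
    simp only [linearIndependent_iff_det, Matrix.det_fin_three, Matrix.of_apply, Matrix.cons_val]
    exact fun h h' => h (by linear_combination -h')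
  have s₂ : ∀ a b c : Fin 3 → ℝ, LinearIndependent ℝ ![a, b, c] →
      LinearIndependent ℝ ![a, c, b] := by
    intro a b c
    simp only [linearIndependent_iff_det, Matrix.det_fin_three, Matrix.of_apply, Matrix.cons_val]
    exact fun h h' => h (by linear_combination -h')
  intro i j k hij hik hjk
  rcases hij.lt_or_gt with hij | hij <;> rcases hik.lt_or_gt with hik | hik <;>
    rcases hjk.lt_or_gt with hjk | hjk
  · exact main _ _ _ hij hjk
  · exact s₂ _ _ _ (main _ _ _ hik hjk)
  · exact absurd (hij.trans hjk) hik.asymm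
  · exact s₂ _ _ _ (s₁ _ _ _ (main _ _ _ hik hij))
  · exact s₁ _ _ _ (main _ _ _ hij hik)
  · exact absurd (hik.trans hjk) hij.asymm
  · exact s₁ _ _ _ (s₂ _ _ _ (main _ _ _ hjk hik))
  · exact s₁ _ _ _ (s₂ _ _ _ (s₁ _ _ _ (main _ _ _ hjk hij)))

theorem ConvexData.segment {x c x' c' : Fin 5 → ℝ} (h : ConvexData x c) (h' : ConvexData x' c')
    {t : ℝ} (h0 : 0 ≤ t) (h1 : t ≤ 1) :
    ConvexData ((1 - t) • x + t • x') ((1 - t) • c + t • c') := by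
  have key : ∀ {a b : ℝ}, 0 < a → 0 < b → 0 < (1 - t) * a + t * b := by
    intro a b ha hb
    rcases h0.eq_or_lt with rfl | h0
    · simpa
    · have := mul_pos h0 hb
      have := mul_nonneg (sub_nonneg.2 h1) ha.le
      linarith
  obtain ⟨l0, l1, l2, l3, p2, p3, p4⟩ := h
  obtain ⟨l0', l1', l2', l3', p2', p3', p4'⟩ := h'
  constructor
  · have := key (sub_pos.2 l0) (sub_pos.2 l0'); simp; linarith
  · have := key (sub_pos.2 l1) (sub_pos.2 l1'); simp; linarith
  · have := key (sub_pos.2 l2) (sub_pos.2 l2'); simp; linarith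
  · have := key (sub_pos.2 l3) (sub_pos.2 l3'); simp; linarith
  · simpa using key p2 p2'
  · simpa using key p3 p3'
  · simpa using key p4 p4'

theorem ConvexData.joinedIn {x c x' c' : Fin 5 → ℝ} (h : ConvexData x c) (h' : ConvexData x' c')
    (hD : ∀ t : ℝ, 0 ≤ t → t ≤ 1 → 0 < outerness ((1 - t) • x + t • x') ((1 - t) • c + t • c')) :
    JoinedIn {f : Fin 6 → RP2 | TypicalCfg f} (fun i => toRP (verticalCfg x (ordinate x c) i))
      fun i => toRP (verticalCfg x' (ordinate x' c') i) := by
  have := joinedIn_of_path (v := fun t => verticalCfg ((1 - t) • x + t • x')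
    (ordinate ((1 - t) • x + t • x') ((1 - t) • c + t • c'))) ?_
    fun t ht => (h.segment h' ht.1 ht.2).typicalVec (hD t ht.1 ht.2)
  · simpa using this
  · refine continuous_pi fun i => ?_
    cases i using Fin.cases with
    | zero => exact continuous_const
    | succ j =>
      simp only [verticalCfg, Fin.cons_succ]
      refine continuous_pi fun l => ?_
      fin_cases l
      · exact continuous_const
      · simp; fun_prop
      · fin_cases j <;> simp [ordinate, deviation] <;> fun_prop

theorem outerness_pos_of_lt {x c : Fin 5 → ℝ} (h : ConvexData x c) (h₂ : c 3 < c 2)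
    (h₄ : c 3 < c 4) : 0 < outerness x c := by
  obtain ⟨l0, l1, l2, l3, p2, p3, p4⟩ := h
  have e : outerness x c = (x 3 - x 1) * (c 2 * c 4 - c 3 * c 3)
      + (x 4 - x 3) * (c 4 * (c 2 - c 3)) + (x 1 - x 0) * (c 2 * (c 4 - c 3)) := by
    unfold outerness; ring
  have a1 : 0 < c 2 * c 4 - c 3 * c 3 := by nlinarith
  have a2 : 0 < x 3 - x 1 := by linarith
  have a3 := sub_pos.2 l3
  have a4 := sub_pos.2 l0
  have a5 := sub_pos.2 h₂
  have a6 := sub_pos.2 h₄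
  rw [e]; positivity

theorem ConvexData.joinedIn_small {x c : Fin 5 → ℝ} (h : ConvexData x c)
    (hD : 0 < outerness x c) : ∃ c', ConvexData x c' ∧ c' 3 < c' 2 ∧ c' 3 < c' 4 ∧
      JoinedIn {f : Fin 6 → RP2 | TypicalCfg f} (fun i => toRP (verticalCfg x (ordinate x c) i))
        fun i => toRP (verticalCfg x (ordinate x c') i) := by
  obtain ⟨m, hm0, hm2, hm3, hm4⟩ : ∃ m, 0 < m ∧ m < c 2 ∧ m < c 3 ∧ m < c 4 := by
    obtain ⟨m, hm, hm'⟩ := exists_between (lt_min (lt_min h.pos₂ h.pos₃) h.pos₄)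
    simp only [lt_min_iff] at hm'
    exact ⟨m, hm, hm'.1.1, hm'.1.2, hm'.2⟩
  have h' : ConvexData x ![c 0, c 1, c 2, m, c 4] := by
    obtain ⟨l0, l1, l2, l3, p2, p3, p4⟩ := h
    constructor <;> simpa
  refine ⟨_, h', by simpa, by simpa, h.joinedIn h' fun t h0 h1 => ?_⟩
  have hx : (1 - t) • x + t • x = x := by rw [← add_smul]; simp
  have hs := h.segment h' h0 h1
  rw [hx] at hs ⊢
  obtain ⟨l0, l1, l2, l3, p2, p3, p4⟩ := hs
  simp only [outerness, Pi.add_apply, Pi.smul_apply, smul_eq_mul, Matrix.cons_val] at hD p2 p3 p4 ⊢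
  have e2 : (1 - t) * c 2 + t * c 2 = c 2 := by ring
  have e4 : (1 - t) * c 4 + t * c 4 = c 4 := by ring
  have e3 : (1 - t) * c 3 + t * m ≤ c 3 := by nlinarith
  rw [e2] at *
  rw [e4] at *
  generalize (1 - t) * c 3 + t * m = r at *
  have a1 : 0 < x 3 - x 1 := by linarith
  have a2 := mul_pos (sub_pos.2 l3) p4
  have a3 := mul_pos (sub_pos.2 l0) p2
  have : r * ((x 3 - x 1) * r + (x 4 - x 3) * c 4 + (x 1 - x 0) * c 2) ≤
      c 3 * ((x 3 - x 1) * c 3 + (x 4 - x 3) * c 4 + (x 1 - x 0) * c 2) := by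
    have := mul_le_mul_of_nonneg_left e3 a1.le
    refine mul_le_mul e3 (by linarith) ?_ h.pos₃.le
    have := mul_pos a1 p3
    linarith
  linarith

/-- All configurations given by convex data whose vertical point is outer are deformation
equivalent. -/
theorem ConvexData.joinedIn_of_outerness_pos {x c x' c' : Fin 5 → ℝ} (h : ConvexData x c)
    (hD : 0 < outerness x c) (h' : ConvexData x' c') (hD' : 0 < outerness x' c') :
    JoinedIn {f : Fin 6 → RP2 | TypicalCfg f} (fun i => toRP (verticalCfg x (ordinate x c) i))
      fun i => toRP (verticalCfg x' (ordinate x' c') i) := by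
  obtain ⟨d, hd, hd2, hd4, hj⟩ := h.joinedIn_small hD
  obtain ⟨d', hd', hd2', hd4', hj'⟩ := h'.joinedIn_small hD'
  refine hj.trans (JoinedIn.trans (hd.joinedIn hd' fun t h0 h1 => ?_) hj'.symm)
  refine outerness_pos_of_lt (hd.segment hd' h0 h1) ?_ ?_ <;>
  · simp only [Pi.add_apply, Pi.smul_apply, smul_eq_mul]
    rcases h0.eq_or_lt with rfl | h0
    · simpa
    · nlinarith

theorem TypicalVec.comp {v : Fin 6 → Fin 3 → ℝ} (h : TypicalVec v) (σ : Equiv.Perm (Fin 6)) :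
    TypicalVec fun i => v (σ i) :=
  ⟨fun _ _ _ hij hik hjk => h.indep _ _ _ (σ.injective.ne hij) (σ.injective.ne hik)
    (σ.injective.ne hjk), fun q hq => h.conic q fun i => by simpa using hq (σ.symm i)⟩

/-- Five points of the plane lie on a conic. -/
theorem exists_conic (v : Fin 5 → Fin 3 → ℝ) :
    ∃ q : QuadraticForm ℝ (Fin 3 → ℝ), q ≠ 0 ∧ ∀ j, q (v j) = 0 := by
  let A : Matrix (Fin 5) (Fin 6) ℝ := fun j =>
    ![v j 0 * v j 0, v j 0 * v j 1, v j 1 * v j 1, v j 0 * v j 2, v j 1 * v j 2, v j 2 * v j 2]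
  obtain ⟨k, hk, hk0⟩ := (Submodule.ne_bot_iff _).1
    (LinearMap.ker_ne_bot_of_finrank_lt (f := A.mulVecLin) (by simp))
  let q : QuadraticForm ℝ (Fin 3 → ℝ) :=
    k 0 • QuadraticMap.proj 0 0 + k 1 • QuadraticMap.proj 0 1 + k 2 • QuadraticMap.proj 1 1
      + k 3 • QuadraticMap.proj 0 2 + k 4 • QuadraticMap.proj 1 2 + k 5 • QuadraticMap.proj 2 2
  have hq : ∀ u : Fin 3 → ℝ, q u = k 0 * (u 0 * u 0) + k 1 * (u 0 * u 1) + k 2 * (u 1 * u 1)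
      + k 3 * (u 0 * u 2) + k 4 * (u 1 * u 2) + k 5 * (u 2 * u 2) := fun u => by
    simp [q]
  refine ⟨q, fun h0 => hk0 ?_, fun j => ?_⟩
  · simp only [h0, zero_apply] at hq
    have e0 := hq ![1, 0, 0]
    have e2 := hq ![0, 1, 0]
    have e5 := hq ![0, 0, 1]
    have e1 := hq ![1, 1, 0]
    have e3 := hq ![1, 0, 1]
    have e4 := hq ![0, 1, 1]
    simp only [Matrix.cons_val] at e0 e1 e2 e3 e4 e5
    ext i
    fin_cases i <;> simp <;> linarith
  · have : A.mulVec k j = 0 := congrFun (LinearMap.mem_ker.1 hk) j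
    simp only [Matrix.mulVec, dotProduct, Fin.sum_univ_six] at this
    simp only [A, Matrix.cons_val] at this
    rw [hq]
    linarith

theorem exists_vec_eq_functional (φ : (Fin 3 → ℝ) →ₗ[ℝ] ℝ) :
    ∃ m : Fin 3 → ℝ, ∀ v, φ v = m 0 * v 0 + m 1 * v 1 + m 2 * v 2 := by
  refine ⟨fun i => φ (Pi.single i 1), fun v => ?_⟩
  rw [LinearMap.pi_apply_eq_sum_univ φ v]
  simp only [Fin.sum_univ_three, smul_eq_mul]
  have : ∀ i : Fin 3, (fun j => if i = j then (1 : ℝ) else 0) = Pi.single i 1 := fun i => by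
    ext j; simp [Pi.single_apply, eq_comm]
  simp only [this]
  ring

/-- Coordinates sending a vertex of a convex polygon to the vertical point at infinity, with the
line at infinity supporting the polygon at this vertex. -/
theorem exists_supporting_coordinates {ι : Type*} [Finite ι] {u : ι → Fin 3 → ℝ}
    {φ : (Fin 3 → ℝ) →ₗ[ℝ] ℝ} (hφ : ∀ i, φ (u i) = 1) {i₀ i₁ : ι} (hne : i₁ ≠ i₀)
    (h : u i₀ ∉ convexHull ℝ (u '' {j | j ≠ i₀})) :
    ∃ B : Matrix (Fin 3) (Fin 3) ℝ, B.det ≠ 0 ∧ B.mulVec (u i₀) = ![0, 0, 1] ∧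
      ∀ j, j ≠ i₀ → 0 < B.mulVec (u j) 0 ∧ B.mulVec (u j) 2 = 1 := by
  obtain ⟨F, s, t, hs, hst, ht⟩ := geometric_hahn_banach_compact_closed
    (convex_singleton (u i₀)) isCompact_singleton (convex_convexHull ℝ _)
    ((Set.toFinite (u '' {j | j ≠ i₀})).isClosed_convexHull ℝ) (Set.disjoint_singleton_left.2 h)
  obtain ⟨n, hn⟩ := exists_vec_eq_functional (F.toLinearMap - F (u i₀) • φ)
  obtain ⟨m, hm⟩ := exists_vec_eq_functional φ
  have hn0 := hn (u i₀)
  have hnj : ∀ j, j ≠ i₀ → 0 < n 0 * u j 0 + n 1 * u j 1 + n 2 * u j 2 := by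
    intro j hj
    have h1 := ht _ (subset_convexHull ℝ _ ⟨j, hj, rfl⟩)
    have h2 := hs _ rfl
    rw [← hn]
    simp [hφ]
    linarith
  simp [hφ] at hn0
  have hm0 := (hm (u i₀)).symm.trans (hφ i₀)
  set p := u i₀
  refine ⟨!![n 0, n 1, n 2; p 1 * n 2 - p 2 * n 1, p 2 * n 0 - p 0 * n 2, p 0 * n 1 - p 1 * n 0;
    m 0, m 1, m 2], ?_, ?_, fun j hj => ⟨?_, ?_⟩⟩
  · have hdet : Matrix.det !![n 0, n 1, n 2; p 1 * n 2 - p 2 * n 1, p 2 * n 0 - p 0 * n 2,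
        p 0 * n 1 - p 1 * n 0; m 0, m 1, m 2] = n 0 ^ 2 + n 1 ^ 2 + n 2 ^ 2 := by
      rw [Matrix.det_fin_three]
      simp only [Matrix.of_apply, Matrix.cons_val]
      linear_combination (n 0 ^ 2 + n 1 ^ 2 + n 2 ^ 2) * hm0
        + (n 0 * m 0 + n 1 * m 1 + n 2 * m 2) * hn0
    rw [hdet]
    intro h0
    have h00 : n 0 = 0 := by nlinarith [sq_nonneg (n 0), sq_nonneg (n 1), sq_nonneg (n 2)]
    have h01 : n 1 = 0 := by nlinarith [sq_nonneg (n 0), sq_nonneg (n 1), sq_nonneg (n 2)]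
    have h02 : n 2 = 0 := by nlinarith [sq_nonneg (n 0), sq_nonneg (n 1), sq_nonneg (n 2)]
    simpa [h00, h01, h02] using hnj i₁ hne
  · ext i
    fin_cases i
    · simp [Matrix.mulVec, dotProduct, Fin.sum_univ_three]
      linarith
    · simp [Matrix.mulVec, dotProduct, Fin.sum_univ_three]
      ring
    · simp [Matrix.mulVec, dotProduct, Fin.sum_univ_three]
      linarith
  · simpa [Matrix.mulVec, dotProduct, Fin.sum_univ_three] using hnj j hj
  · simpa [Matrix.mulVec, dotProduct, Fin.sum_univ_three] using (hm _).symm.trans (hφ j)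

/-- An injective family can be sorted, with a prescribed point put first. -/
theorem exists_perm_strictMono (X : Fin 6 → ℝ) (i₀ : Fin 6)
    (hX : ∀ j k, j ≠ i₀ → k ≠ i₀ → j ≠ k → X j ≠ X k) :
    ∃ σ : Equiv.Perm (Fin 6), σ 0 = i₀ ∧ StrictMono fun j : Fin 5 => X (σ j.succ) := by
  obtain ⟨m, hm⟩ := (Set.finite_range X).bddBelow
  have hm' : ∀ j, m ≤ X j := fun j => hm ⟨j, rfl⟩
  set Y := Function.update X i₀ (m - 1) with hY
  have hY0 : Y i₀ = m - 1 := by simp [hY]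
  have hYj : ∀ j, j ≠ i₀ → Y j = X j := fun j hj => by simp [hY, hj]
  have hinj : Function.Injective Y := by
    intro j k hjk
    by_contra hne
    by_cases hj : j = i₀
    · subst hj
      rw [hY0, hYj k (Ne.symm hne)] at hjk
      linarith [hm' k]
    · by_cases hk : k = i₀
      · subst hk
        rw [hY0, hYj j hj] at hjk
        linarith [hm' j]
      · rw [hYj j hj, hYj k hk] at hjk
        exact hX j k hj hk hne hjk
  have hs : StrictMono (Y ∘ Tuple.sort Y) :=
    (Tuple.monotone_sort Y).strictMono_of_injective (hinj.comp (Tuple.sort Y).injective)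
  have h0 : Tuple.sort Y 0 = i₀ := by
    by_contra hne
    have h1 := hs.monotone (Fin.zero_le ((Tuple.sort Y).symm i₀))
    simp only [Function.comp, Equiv.apply_symm_apply, hY0, hYj _ hne] at h1
    linarith [hm' (Tuple.sort Y 0)]
  refine ⟨Tuple.sort Y, h0, fun j k hjk => ?_⟩
  have hne : ∀ j : Fin 5, Tuple.sort Y j.succ ≠ i₀ := fun j h =>
    absurd ((Tuple.sort Y).injective (h.trans h0.symm)) (Fin.succ_ne_zero j)
  have := hs (Fin.succ_lt_succ_iff.2 hjk)
  simpa only [Function.comp, hYj _ (hne _)] using this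

/-- Every sequence of five points is given by its divided differences. -/
theorem exists_convexData {x y : Fin 5 → ℝ} (hx : StrictMono x)
    (h : ∀ i j k, i < j → j < k → 0 < area x y i j k) :
    ∃ c, ConvexData x c ∧ ordinate x c = y := by
  have l0 : x 0 < x 1 := hx (by decide)
  have l1 : x 1 < x 2 := hx (by decide)
  have l2 : x 2 < x 3 := hx (by decide)
  have l3 : x 3 < x 4 := hx (by decide)
  have a0 := h 0 1 2 (by decide) (by decide)
  have a1 := h 1 2 3 (by decide) (by decide)
  have a2 := h 2 3 4 (by decide) (by decide)
  have g0 := sub_pos.2 l0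
  have g1 := sub_pos.2 l1
  have g2 := sub_pos.2 l2
  have g3 := sub_pos.2 l3
  have b0 := sub_pos.2 (l0.trans l1)
  have b1 := sub_pos.2 (l1.trans l2)
  have b2 := sub_pos.2 (l2.trans l3)
  refine ⟨![y 0, (y 1 - y 0) / (x 1 - x 0),
    area x y 0 1 2 / ((x 1 - x 0) * (x 2 - x 1) * (x 2 - x 0)),
    area x y 1 2 3 / ((x 2 - x 1) * (x 3 - x 2) * (x 3 - x 1)),
    area x y 2 3 4 / ((x 3 - x 2) * (x 4 - x 3) * (x 4 - x 2))],
    ⟨l0, l1, l2, l3, ?_, ?_, ?_⟩, ?_⟩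
  · simp only [Matrix.cons_val]; positivity
  · simp only [Matrix.cons_val]; positivity
  · simp only [Matrix.cons_val]; positivity
  · have := g0.ne'
    have := g1.ne'
    have := g2.ne'
    have := g3.ne'
    have := b0.ne'
    have := b1.ne'
    have := b2.ne'
    ext j
    fin_cases j <;>
      simp only [ordinate, deviation, area, Matrix.cons_val, Fin.zero_eta, Fin.mk_one,
        Fin.reduceFinMk] <;> field_simp <;> ring

theorem Dominant.exists_line {f : Fin 6 → RP2} {i₀ : Fin 6} (hd : Dominant f i₀)
    {u : Fin 6 → Fin 3 → ℝ} (hu : ∀ i, u i ≠ 0) (hf : ∀ i, toRP (u i) = f i)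
    {q : QuadraticForm ℝ (Fin 3 → ℝ)} (hq : q ≠ 0) (hqu : ∀ j, j ≠ i₀ → q (u j) = 0) :
    ∃ v, ∀ s : ℝ, q (v + s • u i₀) ≠ 0 := by
  obtain ⟨L, ⟨W, hW, rfl⟩, hp, hL⟩ := hd q hq fun j hj => by
    obtain ⟨a, -, ha⟩ := exists_smul_eq_rep_toRP (hu j)
    rw [← hf, ha, QuadraticMap.map_smul, hqu j hj, smul_zero]
  have huW : u i₀ ∈ W := by
    obtain ⟨a, ha0, ha⟩ := exists_smul_eq_rep_toRP (hu i₀)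
    rw [Set.mem_ofPred_eq, ← hf, ha] at hp
    exact (W.smul_mem_iff ha0).1 hp
  obtain ⟨v, hvW, hv⟩ : ∃ v ∈ W, v ∉ Submodule.span ℝ {u i₀} := by
    by_contra! h
    have h1 := Submodule.finrank_mono (R := ℝ) (show W ≤ Submodule.span ℝ {u i₀} from h)
    have h2 := finrank_span_singleton (K := ℝ) (hu i₀)
    omega
  refine ⟨v, fun s hs => ?_⟩
  have hne : v + s • u i₀ ≠ 0 := fun h => hv (by
    rw [eq_neg_of_add_eq_zero_left h]
    exact Submodule.neg_mem _ (Submodule.smul_mem _ _ (Submodule.mem_span_singleton_self _)))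
  obtain ⟨a, -, ha⟩ := exists_smul_eq_rep_toRP hne
  refine Set.notMem_empty (toRP (v + s • u i₀)) (hL ▸ ⟨?_, ?_⟩)
  · rw [Set.mem_ofPred_eq, ha]
    exact W.smul_mem _ (W.add_mem hvW (W.smul_mem _ huW))
  · change q _ = 0
    rw [ha, QuadraticMap.map_smul, hs, smul_zero]

/-- In coordinates where a dominant point is the vertical point at infinity, the conic through the
other five points is a hyperbola separated by a vertical line. -/
theorem Dominant.outerness_pos {f : Fin 6 → RP2} (hd : Dominant f 0)
    {u : Fin 6 → Fin 3 → ℝ} (hu : ∀ i, u i ≠ 0) (hf : ∀ i, toRP (u i) = f i)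
    {B : Matrix (Fin 3) (Fin 3) ℝ} (hB : B.det ≠ 0) {a : Fin 6 → ℝ} (ha : ∀ i, 0 < a i)
    {x c : Fin 5 → ℝ} (hx : ConvexData x c)
    (hV : ∀ i, B.mulVec (u i) = a i • verticalCfg x (ordinate x c) i)
    (ht : TypicalVec (verticalCfg x (ordinate x c))) : 0 < outerness x c := by
  by_contra! hle
  obtain ⟨q, hq0, hq⟩ := exists_conic fun j => ![1, x j, ordinate x c j]
  have h0 : q ![0, 0, 1] ≠ 0 := fun h => hq0 (ht.conic q fun i => by
    cases i using Fin.cases with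
    | zero => exact h
    | succ j => exact hq j)
  have hsurj : Function.Surjective B.mulVec :=
    Matrix.mulVec_surjective_iff_isUnit.2 ((Matrix.isUnit_iff_isUnit_det B).2 hB.isUnit)
  obtain ⟨v, hv⟩ := hd.exists_line hu hf (q := q.comp B.mulVecLin) (fun h => hq0 (by
      ext w
      obtain ⟨w, rfl⟩ := hsurj w
      simpa using DFunLike.congr_fun h w)) fun j hj => by
    obtain ⟨j, rfl⟩ := Fin.exists_succ_eq.2 hj
    have : q (verticalCfg x (ordinate x c) j.succ) = 0 := hq j
    simp [hV, QuadraticMap.map_smul, this]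
  obtain ⟨z, hz⟩ := hx.exists_root hle h0 hq (B.mulVec v 0) (B.mulVec v 1)
  refine hv ((z - B.mulVec v 2) / a 0) ?_
  have : B.mulVec v + ((z - B.mulVec v 2) / a 0) • a 0 • verticalCfg x (ordinate x c) 0
      = ![B.mulVec v 0, B.mulVec v 1, z] := by
    rw [smul_smul, div_mul_cancel₀ _ (ha 0).ne']
    ext i
    fin_cases i <;> simp [verticalCfg]
  simpa [Matrix.mulVec_add, Matrix.mulVec_smul, hV, this] using hz

theorem area_pos_of_notMem_convexHull {u : Fin 6 → Fin 3 → ℝ} {φ : (Fin 3 → ℝ) →ₗ[ℝ] ℝ}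
    (hφ : ∀ i, φ (u i) = 1) (hu : ∀ i, u i ∉ convexHull ℝ (u '' {j | j ≠ i}))
    {B : Matrix (Fin 3) (Fin 3) ℝ} (hB : B.det ≠ 0) {a : Fin 6 → ℝ} (ha : ∀ i, 0 < a i)
    {x y : Fin 5 → ℝ} (hx : StrictMono x) (hV : ∀ i, B.mulVec (u i) = a i • verticalCfg x y i)
    (ht : TypicalVec (verticalCfg x y)) {i j k : Fin 5} (hij : i < j) (hjk : j < k) :
    0 < area x y i j k := by
  have hne : area x y i j k ≠ 0 := by
    rw [← det_verticalCfg_succ, ← linearIndependent_iff_det]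
    exact ht.indep _ _ _ (by simpa using hij.ne) (by simpa using (hij.trans hjk).ne)
      (by simpa using hjk.ne)
  by_contra! hle
  have h1 := sub_pos.2 (hx hij)
  have h2 := sub_pos.2 (hx hjk)
  have h3 := sub_pos.2 (hx (hij.trans hjk))
  have hai := ha i.succ
  have haj := ha j.succ
  have hak := ha k.succ
  have ha0 := ha 0
  obtain ⟨α, hα⟩ : ∃ α, α = a j.succ * (x k - x j) / (x k - x i) / a i.succ := ⟨_, rfl⟩
  obtain ⟨β, hβ⟩ : ∃ β, β = a j.succ * (x j - x i) / (x k - x i) / a k.succ := ⟨_, rfl⟩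
  obtain ⟨ε, hε⟩ : ∃ ε, ε = a j.succ * (- area x y i j k) / (x k - x i) / a 0 := ⟨_, rfl⟩
  have hα0 : 0 ≤ α := by rw [hα]; positivity
  have hβ0 : 0 ≤ β := by rw [hβ]; positivity
  have hε0 : 0 ≤ ε := by
    have : 0 ≤ - area x y i j k := by linarith
    rw [hε]; positivity
  have huj : u j.succ = α • u i.succ + β • u k.succ + ε • u 0 := by
    refine Matrix.mulVec_injective_iff_isUnit.2
      ((Matrix.isUnit_iff_isUnit_det B).2 hB.isUnit) ?_
    have e1 : α * a i.succ = a j.succ * (x k - x j) / (x k - x i) := by rw [hα]; field_simp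
    have e2 : β * a k.succ = a j.succ * (x j - x i) / (x k - x i) := by rw [hβ]; field_simp
    have e3 : ε * a 0 = a j.succ * (- area x y i j k) / (x k - x i) := by rw [hε]; field_simp
    simp only [Matrix.mulVec_add, Matrix.mulVec_smul, hV, smul_smul, e1, e2, e3]
    have := h3.ne'
    ext l
    fin_cases l
    · simp [verticalCfg]; field_simp; ring
    · simp [verticalCfg]; field_simp; ring
    · simp [verticalCfg, area]; field_simp; ring
  have hsum : α + β + ε = 1 := by
    have := congrArg φ huj
    simp only [map_add, map_smul, hφ, smul_eq_mul, mul_one] at this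
    exact this.symm
  have hmem : ∀ l, l ≠ j.succ → u l ∈ convexHull ℝ (u '' {l | l ≠ j.succ}) :=
    fun l hl => subset_convexHull ℝ _ ⟨l, hl, rfl⟩
  refine hu j.succ ?_
  have := (convex_convexHull ℝ (u '' {l | l ≠ j.succ})).sum_mem (t := Finset.univ)
    (w := ![α, β, ε]) (z := ![u i.succ, u k.succ, u 0]) (by
      intro l _; fin_cases l <;> simpa) (by simpa [Fin.sum_univ_three] using hsum) (by
      intro l _
      fin_cases l
      · exact hmem _ (by simpa using hij.ne)
      · exact hmem _ (by simpa using hjk.ne')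
      · exact hmem _ (Fin.succ_ne_zero j).symm)
  simp only [Fin.sum_univ_three, Matrix.cons_val] at this
  rwa [← huj] at this

/-- A dominant point of a hexagonal configuration can be moved to the vertical point at infinity,
the other points being moved to a convex chain. -/
theorem exists_joinedIn_verticalCfg {f : Fin 6 → RP2} (hf : TypicalCfg f) (hc : ConvexPos f)
    {i₀ : Fin 6} (hd : Dominant f i₀) :
    ∃ σ : Equiv.Perm (Fin 6), σ 0 = i₀ ∧ ∃ x c, ConvexData x c ∧ 0 < outerness x c ∧
      JoinedIn {f : Fin 6 → RP2 | TypicalCfg f} (f ∘ σ)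
        fun i => toRP (verticalCfg x (ordinate x c) i) := by
  obtain ⟨φ, -, hφ0, hconv⟩ := hc
  set u : Fin 6 → Fin 3 → ℝ := fun i => chart φ (f i) with hu
  have hφ : ∀ i, φ (u i) = 1 := fun i => by simp [hu, chart, inv_mul_cancel₀ (hφ0 i)]
  have hty : TypicalVec u := ((typicalCfg_iff f).1 hf).smul fun i => inv_ne_zero (hφ0 i)
  have hfu : ∀ i, toRP (u i) = f i := fun i => by
    change toRP ((φ (f i).rep)⁻¹ • (f i).rep) = f i
    rw [toRP_smul (inv_ne_zero (hφ0 i)), toRP_rep]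
  have hhull : ∀ i, u i ∉ convexHull ℝ (u '' {j | j ≠ i}) := fun i => by
    have := hconv i
    rwa [Set.image_image] at this
  obtain ⟨i₁, hi₁⟩ := exists_ne i₀
  obtain ⟨B, hB, hB0, hBj⟩ := exists_supporting_coordinates hφ hi₁ (hhull i₀)
  have hX : ∀ j k, j ≠ i₀ → k ≠ i₀ → j ≠ k →
      B.mulVec (u j) 1 / B.mulVec (u j) 0 ≠ B.mulVec (u k) 1 / B.mulVec (u k) 0 := by
    intro j k hj hk hjk h
    have hind := (hty.mulVec hB).indep i₀ j k hj.symm hk.symm hjk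
    rw [linearIndependent_iff_det] at hind
    rw [div_eq_div_iff (hBj j hj).1.ne' (hBj k hk).1.ne'] at h
    refine hind ?_
    simp [Matrix.det_fin_three, hB0]
    linarith
  obtain ⟨σ, hσ, hmono⟩ := exists_perm_strictMono _ i₀ hX
  have hσne : ∀ j : Fin 5, σ j.succ ≠ i₀ := fun j h =>
    absurd (σ.injective (h.trans hσ.symm)) (Fin.succ_ne_zero j)
  obtain ⟨x, hxdef⟩ : ∃ x : Fin 5 → ℝ,
      x = fun j => B.mulVec (u (σ j.succ)) 1 / B.mulVec (u (σ j.succ)) 0 := ⟨_, rfl⟩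
  obtain ⟨y, hydef⟩ : ∃ y : Fin 5 → ℝ, y = fun j => 1 / B.mulVec (u (σ j.succ)) 0 := ⟨_, rfl⟩
  obtain ⟨a, hadef⟩ : ∃ a : Fin 6 → ℝ,
      a = Fin.cons 1 fun j : Fin 5 => B.mulVec (u (σ j.succ)) 0 := ⟨_, rfl⟩
  have ha : ∀ i, 0 < a i := by
    intro i
    cases i using Fin.cases with
    | zero => simp [hadef]
    | succ j => simpa [hadef] using (hBj _ (hσne j)).1
  have hV : ∀ i, B.mulVec (u (σ i)) = a i • verticalCfg x y i := by
    intro i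
    cases i using Fin.cases with
    | zero => simp [hadef, verticalCfg, hσ, hB0]
    | succ j =>
      obtain ⟨h0, h2⟩ := hBj _ (hσne j)
      ext l
      fin_cases l
      · simp [hadef, verticalCfg]
      · simp [hadef, verticalCfg, hxdef, mul_div_cancel₀ _ h0.ne']
      · simp [hadef, verticalCfg, hydef, h2, mul_inv_cancel₀ h0.ne']
  have htσ : TypicalVec fun i => u (σ i) := hty.comp σ
  have htV : TypicalVec (verticalCfg x y) := by
    have := (htσ.mulVec hB).smul fun i => inv_ne_zero (ha i).ne'
    simpa only [hV, smul_smul, inv_mul_cancel₀ (ha _).ne', one_smul] using this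
  have hx : StrictMono x := hxdef ▸ hmono
  have hhullσ : ∀ i, u (σ i) ∉ convexHull ℝ ((fun i => u (σ i)) '' {j | j ≠ i}) := fun i h =>
    hhull (σ i) (convexHull_mono (by
      rintro _ ⟨j, hj, rfl⟩
      exact ⟨σ j, σ.injective.ne hj, rfl⟩) h)
  obtain ⟨c, hxc, rfl⟩ := exists_convexData hx fun i j k hij hjk =>
    area_pos_of_notMem_convexHull (fun i => hφ (σ i)) hhullσ hB ha hx hV htV hij hjk
  have hdσ : Dominant (f ∘ σ) 0 := fun q hq h => by
    have := hd q hq fun j hj => by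
      simpa using h (σ.symm j) fun h => hj (by rw [← hσ, ← h, σ.apply_symm_apply])
    simpa [hσ] using this
  refine ⟨σ, hσ, x, c, hxc,
    hdσ.outerness_pos htσ.ne_zero (fun i => hfu (σ i)) hB ha hxc hV htV, ?_⟩
  have := actsByDeformation hB _ htσ
  simpa only [hV, hfu, toRP_smul (ha _).ne', Function.comp_def] using this

end

noncomputable section

/-- Given two hexagonal typical 6-configurations with marked dominant points, there is a
Q-deformation from the first configuration to the second taking the first marked point to
the second one. -/
theorem qdeformation_taking_dominant_to_dominant
    (f g : Fin 6 → RP2) (hf : TypicalCfg f) (hg : TypicalCfg g)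
    (hfc : ConvexPos f) (hgc : ConvexPos g)
    (i₀ i₁ : Fin 6) (hd₀ : Dominant f i₀) (hd₁ : Dominant g i₁) :
    ∃ γ : Fin 6 → unitInterval → RP2, QDeformFam 6 γ ∧
      (Set.range fun i => γ i 0) = Set.range f ∧
      (Set.range fun i => γ i 1) = Set.range g ∧
      γ 0 0 = f i₀ ∧ γ 0 1 = g i₁ := by
  obtain ⟨σ, rfl, x, c, hx, hD, hfσ⟩ := exists_joinedIn_verticalCfg hf hfc hd₀
  obtain ⟨τ, rfl, x', c', hx', hD', hgτ⟩ := exists_joinedIn_verticalCfg hg hgc hd₁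
  obtain ⟨p, hp⟩ := (hfσ.trans (hx.joinedIn_of_outerness_pos hD hx' hD')).trans hgτ.symm
  refine ⟨fun i t => p t i, ⟨fun i => (continuous_apply i).comp p.continuous, hp⟩, ?_, ?_, ?_, ?_⟩
  · simpa [p.source, Function.comp_def] using σ.surjective.range_comp f
  · simpa [p.target, Function.comp_def] using τ.surjective.range_comp g
  · simp [p.source]
  · simp [p.target]

end
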